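/- The logical operator vectors satisfy: ω(X̄_L, w) = 0 and ω(Z̄_L, w) = 0 for every check vector w (every H(i,j) and every W(i,j)); ω(X̄_L, Z̄_L) = 1; and neither X̄_L nor Z̄_L lies in the check span G. (Hence X̄_L and Z̄_L represent the anticommuting bare logical pair of the Bacon-Shor code.) -/

import Mathlib

open Finset

/-- The F₂-vector space of Pauli operators (mod phase) on the m×n grid:
first component is the X-support, second the Z-support. -/
abbrev V (m n : ℕ) := ((Fin m × Fin n) → ZMod 2) × ((Fin m × Fin n) → ZMod 2)

/-- Symplectic form: two Paulis commute iff `omega` of their vectors is 0. -/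
def omega {m n : ℕ} (v w : V m n) : ZMod 2 :=
  ∑ q : Fin m × Fin n, (v.1 q * w.2 q + w.1 q * v.2 q)

/-- Horizontal XX check H(i,j): X-part the indicator of {(i,j),(i+1,j)}
(here i ranges over Fin (m-1), i.e. 0 ≤ i ≤ m−2). -/
def Hcheck {m n : ℕ} (i : Fin (m - 1)) (j : Fin n) : V m n :=
  (fun q => if (q.1.val = i.val ∨ q.1.val = i.val + 1) ∧ q.2 = j then 1 else 0, 0)

/-- Vertical ZZ check W(i,j): Z-part the indicator of {(i,j),(i,j+1)}
(here j ranges over Fin (n-1), i.e. 0 ≤ j ≤ n−2). -/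
def Wcheck {m n : ℕ} (i : Fin m) (j : Fin (n - 1)) : V m n :=
  (0, fun q => if q.1 = i ∧ (q.2.val = j.val ∨ q.2.val = j.val + 1) then 1 else 0)

/-- The F₂-span G of all Bacon-Shor check vectors. -/
def checkSpan (m n : ℕ) : Submodule (ZMod 2) (V m n) :=
  Submodule.span (ZMod 2)
    ((Set.range fun p : Fin (m - 1) × Fin n => Hcheck p.1 p.2) ∪
     (Set.range fun p : Fin m × Fin (n - 1) => Wcheck p.1 p.2))

/-- `omega · w` as a linear map in the first argument. -/
def omegaR {m n : ℕ} (w : V m n) : V m n →ₗ[ZMod 2] ZMod 2 where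
  toFun v := omega v w
  map_add' a b := by
    simp only [omega, Prod.fst_add, Prod.snd_add, Pi.add_apply]
    rw [← Finset.sum_add_distrib]
    exact Finset.sum_congr rfl fun q _ => by ring
  map_smul' c a := by
    simp only [omega, Prod.smul_fst, Prod.smul_snd, Pi.smul_apply, smul_eq_mul,
      RingHom.id_apply, Finset.mul_sum]
    exact Finset.sum_congr rfl fun q _ => by ring

/-- The radical {v ∈ G : ∀ w ∈ G, ω(v,w) = 0} of the symplectic form on G. -/
def radical (m n : ℕ) : Submodule (ZMod 2) (V m n) :=
  checkSpan m n ⊓ ⨅ w ∈ checkSpan m n, LinearMap.ker (omegaR w)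

/-- The centralizer {v ∈ V : ∀ w ∈ G, ω(v,w) = 0} of the check span. -/
def centralizer (m n : ℕ) : Submodule (ZMod 2) (V m n) :=
  ⨅ w ∈ checkSpan m n, LinearMap.ker (omegaR w)

/-- Vertical X-type stabilizer S^X_i (i = 1,…,m−1 encoded as Fin (m-1) via i ↦ i−1):
X-part the indicator of {i−1,i} × Fin n. -/
def SX {m n : ℕ} (i : Fin (m - 1)) : V m n :=
  (fun q => if q.1.val = i.val ∨ q.1.val = i.val + 1 then 1 else 0, 0)

/-- Horizontal Z-type stabilizer S^Z_j (j = 1,…,n−1 encoded as Fin (n-1) via j ↦ j−1):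
Z-part the indicator of Fin m × {j−1,j}. -/
def SZ {m n : ℕ} (j : Fin (n - 1)) : V m n :=
  (0, fun q => if q.2.val = j.val ∨ q.2.val = j.val + 1 then 1 else 0)

/-- Logical X̄_L: X-part the indicator of {0} × Fin n. -/
def XL {m n : ℕ} : V m n :=
  (fun q => if q.1.val = 0 then 1 else 0, 0)

/-- Logical Z̄_L: Z-part the indicator of Fin m × {0}. -/
def ZL {m n : ℕ} : V m n :=
  (0, fun q => if q.2.val = 0 then 1 else 0)

/-- Gauge qubit X̄_{a,b} (1 ≤ a ≤ m−1, 1 ≤ b ≤ n−1, encoded as Fin (m-1) × Fin (n-1)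
via (a,b) ↦ (a−1,b−1)): X-part the indicator of {a−1,a} × {b,…,n−1}. -/
def gaugeX {m n : ℕ} (a : Fin (m - 1)) (b : Fin (n - 1)) : V m n :=
  (fun q => if (q.1.val = a.val ∨ q.1.val = a.val + 1) ∧ b.val + 1 ≤ q.2.val then 1 else 0, 0)

/-- Gauge qubit Z̄_{a,b}: Z-part the indicator of {a,…,m−1} × {b−1,b}. -/
def gaugeZ {m n : ℕ} (a : Fin (m - 1)) (b : Fin (n - 1)) : V m n :=
  (0, fun q => if a.val + 1 ≤ q.1.val ∧ (q.2.val = b.val ∨ q.2.val = b.val + 1) then 1 else 0)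

/-- Destabilizer D^X_j: X-part the indicator of {0} × {j,…,n−1}. -/
def DX {m n : ℕ} (j : Fin (n - 1)) : V m n :=
  (fun q => if q.1.val = 0 ∧ j.val + 1 ≤ q.2.val then 1 else 0, 0)

/-- Destabilizer D^Z_i: Z-part the indicator of {i,…,m−1} × {0}. -/
def DZ {m n : ℕ} (i : Fin (m - 1)) : V m n :=
  (0, fun q => if i.val + 1 ≤ q.1.val ∧ q.2.val = 0 then 1 else 0)


/-- The indicator of two consecutive points of `Fin k` has even weight. -/
theorem sum_indicator_consecutive {k : ℕ} (t : Fin (k - 1)) :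
    ∑ a : Fin k, (if a.val = t.val ∨ a.val = t.val + 1 then (1 : ZMod 2) else 0) = 0 := by
  have ht := t.isLt
  have h : (univ.filter fun a : Fin k => a.val = t.val ∨ a.val = t.val + 1) =
      {⟨t.val, by omega⟩, ⟨t.val + 1, by omega⟩} := by
    ext a
    simp [Fin.ext_iff]
  rw [Finset.sum_boole, h, Finset.card_pair (by simp)]
  rfl

theorem omega_XL_Hcheck {m n : ℕ} (i : Fin (m - 1)) (j : Fin n) :
    omega (XL (m := m) (n := n)) (Hcheck i j) = 0 := by
  simp [omega, XL, Hcheck]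

theorem omega_ZL_Wcheck {m n : ℕ} (i : Fin m) (j : Fin (n - 1)) :
    omega (ZL (m := m) (n := n)) (Wcheck i j) = 0 := by
  simp [omega, ZL, Wcheck]

theorem omega_XL_Wcheck {m n : ℕ} (i : Fin m) (j : Fin (n - 1)) :
    omega (XL (m := m) (n := n)) (Wcheck i j) = 0 := by
  simp only [omega, XL, Wcheck, Pi.zero_apply, zero_mul, add_zero, Fintype.sum_prod_type,
    ite_and]
  refine Finset.sum_eq_zero fun a _ => ?_
  split_ifs <;> simp [sum_indicator_consecutive, -Finset.sum_boole]

theorem omega_ZL_Hcheck {m n : ℕ} (i : Fin (m - 1)) (j : Fin n) :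
    omega (ZL (m := m) (n := n)) (Hcheck i j) = 0 := by
  simp only [omega, ZL, Hcheck, Pi.zero_apply, zero_mul, zero_add, Fintype.sum_prod_type_right,
    and_comm (b := _ = j), ite_and]
  refine Finset.sum_eq_zero fun b _ => ?_
  split_ifs <;> simp [sum_indicator_consecutive, -Finset.sum_boole]

theorem omega_comm {m n : ℕ} (v w : V m n) : omega v w = omega w v :=
  Finset.sum_congr rfl fun _ _ => add_comm _ _

theorem omega_XL_ZL {m n : ℕ} (hm : 0 < m) (hn : 0 < n) :
    omega (XL (m := m) (n := n)) (ZL (m := m) (n := n)) = 1 := by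
  obtain ⟨m, rfl⟩ := Nat.exists_eq_succ_of_ne_zero hm.ne'
  obtain ⟨n, rfl⟩ := Nat.exists_eq_succ_of_ne_zero hn.ne'
  simp [omega, XL, ZL, Fintype.sum_prod_type]

/-- A vector commuting with every check commutes with the whole check span. -/
theorem omega_eq_zero_of_mem_checkSpan {m n : ℕ} {u v : V m n}
    (hH : ∀ i j, omega u (Hcheck i j) = 0) (hW : ∀ i j, omega u (Wcheck i j) = 0)
    (hv : v ∈ checkSpan m n) : omega v u = 0 := by
  have hle : checkSpan m n ≤ LinearMap.ker (omegaR u) := by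
    refine Submodule.span_le.2 ?_
    rintro _ (⟨p, rfl⟩ | ⟨p, rfl⟩)
    · exact (omega_comm _ _).trans (hH p.1 p.2)
    · exact (omega_comm _ _).trans (hW p.1 p.2)
  exact hle hv

/-- X̄_L and Z̄_L symplectically commute with every check, anticommute with each
other, and neither lies in the check span G. -/
theorem stmt7 (m n : ℕ) (hm : 2 ≤ m) (hn : 2 ≤ n) :
    (∀ (i : Fin (m - 1)) (j : Fin n), omega (XL (m := m) (n := n)) (Hcheck i j) = 0) ∧
    (∀ (i : Fin m) (j : Fin (n - 1)), omega (XL (m := m) (n := n)) (Wcheck i j) = 0) ∧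
    (∀ (i : Fin (m - 1)) (j : Fin n), omega (ZL (m := m) (n := n)) (Hcheck i j) = 0) ∧
    (∀ (i : Fin m) (j : Fin (n - 1)), omega (ZL (m := m) (n := n)) (Wcheck i j) = 0) ∧
    omega (XL (m := m) (n := n)) (ZL (m := m) (n := n)) = 1 ∧
    XL (m := m) (n := n) ∉ checkSpan m n ∧
    ZL (m := m) (n := n) ∉ checkSpan m n := by
  have hXZ := omega_XL_ZL (m := m) (n := n) (by omega) (by omega)
  refine ⟨omega_XL_Hcheck, omega_XL_Wcheck, omega_ZL_Hcheck, omega_ZL_Wcheck, hXZ,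
    fun hX => ?_, fun hZ => ?_⟩
  · rw [omega_eq_zero_of_mem_checkSpan omega_ZL_Hcheck omega_ZL_Wcheck hX] at hXZ
    exact zero_ne_one hXZ
  · rw [omega_comm, omega_eq_zero_of_mem_checkSpan omega_XL_Hcheck omega_XL_Wcheck hZ] at hXZ
    exact zero_ne_one hXZ
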